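/- Let θ_g = (1+√5)/2, let a, b > 0 with a/b = θ_g, and let α ∈ ℝ satisfy −π²/(√5·a) < α < −(2π/a)·tan((3−√5)π/4). Then the gap set G₋(α) is nonempty and has only finitely many connected components; i.e., there is a nonzero and finite number of gaps in the positive spectrum. -/

import Mathlib

open Real

/-- The gap condition set for a rectangular-lattice quantum graph with edge lengths
`a, b` and coupling `α > 0`. -/
def gapSetPlus (a b α : ℝ) : Set ℝ :=
  {k : ℝ | 0 < k ∧ (∀ n : ℤ, k * a / π ≠ n) ∧ (∀ n : ℤ, k * b / π ≠ n) ∧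
    2 * k * (Real.tan (k * a / 2 - π / 2 * ⌊k * a / π⌋)
      + Real.tan (k * b / 2 - π / 2 * ⌊k * b / π⌋)) < α}

/-- The gap condition set for a rectangular-lattice quantum graph with edge lengths
`a, b` and coupling `α < 0`. -/
def gapSetMinus (a b α : ℝ) : Set ℝ :=
  {k : ℝ | 0 < k ∧ (∀ n : ℤ, k * a / π ≠ n) ∧ (∀ n : ℤ, k * b / π ≠ n) ∧
    2 * k * (Real.cot (k * a / 2 - π / 2 * ⌊k * a / π⌋)
      + Real.cot (k * b / 2 - π / 2 * ⌊k * b / π⌋)) < |α|}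

/-- The collection of connected components of a set `G ⊆ ℝ`; open spectral gaps
correspond to its elements. -/
def gapComponents (G : Set ℝ) : Set (Set ℝ) :=
  {C : Set ℝ | ∃ k ∈ G, C = connectedComponentIn G k}

theorem Real.pi_div_two_sub_le_cot {y : ℝ} (h0 : 0 < y) (h1 : y < π / 2) :
    π / 2 - y ≤ Real.cot y := by
  have h := Real.le_tan (x := π / 2 - y) (by linarith) (by linarith)
  rwa [Real.tan_pi_div_two_sub, Real.tan_inv_eq_cot] at h

theorem Real.cot_le_cot_of_le {y z : ℝ} (hy : 0 < y) (hyz : y ≤ z) (hz : z < π / 2) :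
    Real.cot z ≤ Real.cot y := by
  have hpi := Real.pi_pos
  have hsy : 0 < sin y := sin_pos_of_pos_of_lt_pi hy (by linarith)
  have hsz : 0 < sin z := sin_pos_of_pos_of_lt_pi (by linarith) (by linarith)
  rw [Real.cot_eq_cos_div_sin, Real.cot_eq_cos_div_sin, div_le_div_iff₀ hsz hsy]
  have h := sin_nonneg_of_nonneg_of_le_pi (x := z - y) (by linarith) (by linarith)
  rw [sin_sub] at h
  linarith

theorem Real.mul_cot_le_mul_cot_of_le {y z : ℝ} (hy : 0 < y) (hyz : y ≤ z) (hz : z < π / 2) :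
    z * Real.cot z ≤ y * Real.cot y := by
  have hpi := Real.pi_pos
  have hsin : ∀ t ∈ Set.Ioo 0 (π / 2), 0 < sin t := fun t ht =>
    sin_pos_of_pos_of_lt_pi ht.1 (by linarith [ht.2])
  have hderiv : ∀ t ∈ Set.Ioo 0 (π / 2), HasDerivAt (fun t => t * (cos t / sin t))
      (1 * (cos t / sin t) + t * ((-sin t * sin t - cos t * cos t) / sin t ^ 2)) t :=
    fun t ht => (hasDerivAt_id t).mul
      ((hasDerivAt_cos t).div (hasDerivAt_sin t) (hsin t ht).ne')
  have hanti : AntitoneOn (fun t => t * (cos t / sin t)) (Set.Ioo 0 (π / 2)) := by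
    apply antitoneOn_of_deriv_nonpos (convex_Ioo _ _)
    · exact fun t ht => (hderiv t ht).continuousAt.continuousWithinAt
    · rw [interior_Ioo]
      exact fun t ht => (hderiv t ht).differentiableAt.differentiableWithinAt
    · rw [interior_Ioo]
      intro t ht
      have hs := hsin t ht
      rw [(hderiv t ht).deriv]
      have hform : 1 * (cos t / sin t) + t * ((-sin t * sin t - cos t * cos t) / sin t ^ 2)
          = (sin t * cos t - t) / sin t ^ 2 := by
        have hone := sin_sq_add_cos_sq t
        field_simp
        linear_combination (-t) * hone
      rw [hform]
      apply div_nonpos_of_nonpos_of_nonneg _ (by positivity)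
      have h1 := sin_lt ht.1
      have h2 := cos_le_one t
      nlinarith
  simpa only [Real.cot_eq_cos_div_sin] using
    hanti ⟨hy, by linarith⟩ ⟨by linarith, hz⟩ hyz

/-- The reduced phase entering the gap condition is `π / 2` times a fractional part. -/
theorem half_sub_floor_eq (x : ℝ) (k a : ℝ) (hx : k * a / π = x) :
    k * a / 2 - π / 2 * ⌊k * a / π⌋ = π / 2 * Int.fract x := by
  subst hx
  rw [Int.fract]
  have := Real.pi_pos
  field_simp

theorem fract_pos_of_forall_ne {x : ℝ} (hx : ∀ n : ℤ, x ≠ n) : 0 < Int.fract x :=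
  Int.fract_pos.2 (hx _)

/-- Within one cell between consecutive multiples of `π / a`, each summand of the gap function
is decreasing. -/
theorem mul_cot_reduced_le {a k l : ℝ} (ha : 0 < a) (hk : 0 < k) (hkl : k ≤ l)
    (hk' : ∀ n : ℤ, k * a / π ≠ n) (hfl : ⌊l * a / π⌋ = ⌊k * a / π⌋) :
    l * Real.cot (l * a / 2 - π / 2 * ⌊l * a / π⌋)
      ≤ k * Real.cot (k * a / 2 - π / 2 * ⌊k * a / π⌋) := by
  have hpi := Real.pi_pos
  have h0 : 0 < k * a / 2 - π / 2 * ⌊k * a / π⌋ := by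
    rw [half_sub_floor_eq _ k a rfl]
    exact mul_pos (by positivity) (fract_pos_of_forall_ne hk')
  have h1 : l * a / 2 - π / 2 * ⌊l * a / π⌋ < π / 2 := by
    rw [half_sub_floor_eq _ l a rfl]
    have := Int.fract_lt_one (l * a / π)
    nlinarith
  have hi : (0 : ℝ) ≤ ⌊k * a / π⌋ := by
    exact_mod_cast Int.floor_nonneg.2 (by positivity)
  rw [hfl] at h1 ⊢
  set i : ℝ := (⌊k * a / π⌋ : ℝ)
  have hle : k * a / 2 - π / 2 * i ≤ l * a / 2 - π / 2 * i := by
    have := mul_le_mul_of_nonneg_right hkl ha.le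
    linarith
  have hA := Real.mul_cot_le_mul_cot_of_le h0 hle h1
  have hB := mul_le_mul_of_nonneg_left (Real.cot_le_cot_of_le h0 hle h1)
    (mul_nonneg (by positivity : (0 : ℝ) ≤ π / 2) hi)
  refine le_of_mul_le_mul_left ?_ (by positivity : 0 < a / 2)
  linarith

/-- The part of the gap set lying in a single cell, on which both floors are constant. -/
def gapCell (a b α : ℝ) (p : ℤ × ℤ) : Set ℝ :=
  {k | k ∈ gapSetMinus a b α ∧ ⌊k * a / π⌋ = p.1 ∧ ⌊k * b / π⌋ = p.2}

theorem floor_eq_and_forall_ne_of_le {c x y z : ℝ} (hc : 0 < c) (hxy : x ≤ y) (hyz : y ≤ z)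
    (hx : ∀ n : ℤ, x * c / π ≠ n) (hf : ⌊x * c / π⌋ = ⌊z * c / π⌋) :
    ⌊y * c / π⌋ = ⌊x * c / π⌋ ∧ ∀ n : ℤ, y * c / π ≠ n := by
  have hpi := Real.pi_pos
  have h1 : x * c / π ≤ y * c / π := by gcongr
  have h2 : y * c / π ≤ z * c / π := by gcongr
  have hfl : ⌊y * c / π⌋ = ⌊x * c / π⌋ :=
    le_antisymm (hf ▸ Int.floor_le_floor h2) (Int.floor_le_floor h1)
  refine ⟨hfl, fun n hn => ?_⟩
  have hn' : ⌊x * c / π⌋ = n := by rw [← hfl, hn, Int.floor_intCast]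
  have h3 := Int.floor_le (x * c / π)
  rw [hn'] at h3
  exact hx n (le_antisymm (hn ▸ h1) h3)

theorem isPreconnected_gapCell {a b : ℝ} (ha : 0 < a) (hb : 0 < b) (α : ℝ) (p : ℤ × ℤ) :
    IsPreconnected (gapCell a b α p) := by
  apply Set.OrdConnected.isPreconnected
  refine ⟨?_⟩
  rintro x ⟨⟨hx0, hxa, hxb, hx⟩, hxi, hxj⟩ z ⟨-, hzi, hzj⟩ y ⟨hxy, hyz⟩
  obtain ⟨hya, hya'⟩ := floor_eq_and_forall_ne_of_le ha hxy hyz hxa (hxi.trans hzi.symm)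
  obtain ⟨hyb, hyb'⟩ := floor_eq_and_forall_ne_of_le hb hxy hyz hxb (hxj.trans hzj.symm)
  refine ⟨⟨hx0.trans_le hxy, hya', hyb', ?_⟩, hya.trans hxi, hyb.trans hxj⟩
  have h1 := mul_cot_reduced_le ha hx0 hxy hxa hya
  have h2 := mul_cot_reduced_le hb hx0 hxy hxb hyb
  linarith

theorem finite_gapComponents_of_subset_iUnion {ι : Type*} {G : Set ℝ} {P : ι → Set ℝ}
    {F : Set ι} (hF : F.Finite) (hP : ∀ i, IsPreconnected (P i)) (hPG : ∀ i, P i ⊆ G)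
    (hG : ∀ k ∈ G, ∃ i ∈ F, k ∈ P i) : (gapComponents G).Finite := by
  classical
  refine (hF.image fun i =>
    if h : (P i).Nonempty then connectedComponentIn G h.some else ∅).subset ?_
  rintro C ⟨k, hk, rfl⟩
  obtain ⟨i, hi, hki⟩ := hG k hk
  have h : (P i).Nonempty := ⟨k, hki⟩
  refine ⟨i, hi, ?_⟩
  simp only [dif_pos h]
  exact connectedComponentIn_eq
    ((hP i).subset_connectedComponentIn h.some_mem (hPG i) hki)

theorem sq_sub_mul_sub_sq_ne_zero (m : ℤ) {n : ℤ} (hn : n ≠ 0) :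
    m ^ 2 - m * n - n ^ 2 ≠ 0 := by
  intro h
  have h5 : Irrational (√5) := by
    simpa using Nat.Prime.irrational_sqrt (p := 5) (by norm_num)
  have hn' : (n : ℝ) ≠ 0 := by exact_mod_cast hn
  have hR : (m : ℝ) ^ 2 - m * n - n ^ 2 = 0 := by exact_mod_cast h
  refine h5 ⟨|(2 * m - n : ℚ) / n|, ?_⟩
  push_cast
  rw [← Real.sqrt_sq_eq_abs]
  congr 1
  field_simp
  linear_combination 4 * hR

/-- Simultaneous approximation from above of `x` and `x / φ` by integers cannot be better than
the Hurwitz constant allows. -/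
theorem sq_mul_one_sub_le_of_approx {m n : ℤ} {s x u v c : ℝ} (hs : 0 ≤ s) (hs5 : s ^ 2 = 5)
    (hx : 0 < x) (hu : 0 ≤ u) (hv : 0 ≤ v) (hm : (m : ℝ) = x + u)
    (hn : (n : ℝ) = x * ((s - 1) / 2) + v) (hc : x * (u + v) ≤ c) :
    x ^ 2 * (1 - s * c) ≤ 2 * c ^ 2 := by
  have hs2 : 2 < s := by nlinarith
  have hs3 : s < 3 := by nlinarith
  have hn0 : n ≠ 0 := by
    rintro rfl
    have : 0 < x * ((s - 1) / 2) := by apply mul_pos hx; linarith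
    push_cast at hn
    linarith
  have hN : (1 : ℝ) ≤ |(m : ℝ) ^ 2 - m * n - n ^ 2| := by
    exact_mod_cast Int.one_le_abs (sq_sub_mul_sub_sq_ne_zero m hn0)
  have hw : 0 ≤ u + v := by positivity
  have hid : (m : ℝ) ^ 2 - m * n - n ^ 2
      = (u - v * ((1 + s) / 2)) * (x * s * ((s - 1) / 2) + u + v * ((s - 1) / 2)) := by
    rw [hm, hn]
    linear_combination (x * s * v / 4 + v ^ 2 / 4 - x ^ 2 / 4 - x * u / 2) * hs5
  have hA : |u - v * ((1 + s) / 2)| ≤ (1 + s) / 2 * (u + v) := by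
    rw [abs_le]
    constructor <;> nlinarith
  have hB : 0 ≤ x * s * ((s - 1) / 2) + u + v * ((s - 1) / 2) := by
    have : 0 ≤ s - 1 := by linarith
    positivity
  have hB' : x * s * ((s - 1) / 2) + u + v * ((s - 1) / 2) ≤ x * s * ((s - 1) / 2) + (u + v) := by
    nlinarith
  have hub : |(m : ℝ) ^ 2 - m * n - n ^ 2| ≤ s * (x * (u + v)) + 2 * (u + v) ^ 2 := by
    rw [hid, abs_mul, abs_of_nonneg hB]
    calc _ ≤ (1 + s) / 2 * (u + v) * (x * s * ((s - 1) / 2) + (u + v)) := by gcongr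
      _ = s * (x * (u + v)) + (1 + s) / 2 * (u + v) ^ 2 := by
          linear_combination (x * s * (u + v) / 4) * hs5
      _ ≤ _ := by gcongr; linarith
  have h1 : (1 : ℝ) ≤ s * c + 2 * (u + v) ^ 2 := by
    have := mul_le_mul_of_nonneg_left hc hs
    linarith
  have h2 : (x * (u + v)) ^ 2 ≤ c ^ 2 := by gcongr
  have h3 := mul_le_mul_of_nonneg_left h1 (sq_nonneg x)
  linarith

theorem one_sub_fract_le_cot {k a : ℝ} (hk : ∀ n : ℤ, k * a / π ≠ n) :
    π / 2 * (1 - Int.fract (k * a / π)) ≤ Real.cot (k * a / 2 - π / 2 * ⌊k * a / π⌋) := by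
  have hpi := Real.pi_pos
  rw [half_sub_floor_eq _ k a rfl]
  have h0 := fract_pos_of_forall_ne hk
  have h1 := Int.fract_lt_one (k * a / π)
  have := Real.pi_div_two_sub_le_cot (y := π / 2 * Int.fract (k * a / π)) (by positivity)
    (by nlinarith)
  linarith

theorem sq_le_of_mem_gapSetMinus {a b α k s : ℝ} (ha : 0 < a) (hs : 0 ≤ s) (hs5 : s ^ 2 = 5)
    (hb : b = a * ((s - 1) / 2)) (hα : s * (|α| * a / π ^ 2) < 1)
    (hk : k ∈ gapSetMinus a b α) :
    (k * a / π) ^ 2 ≤ 2 * (|α| * a / π ^ 2) ^ 2 / (1 - s * (|α| * a / π ^ 2)) := by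
  have hpi := Real.pi_pos
  obtain ⟨hk0, hka, hkb, hlt⟩ := hk
  have h1 := one_sub_fract_le_cot hka
  have h2 := one_sub_fract_le_cot hkb
  rw [le_div_iff₀ (by linarith)]
  refine sq_mul_one_sub_le_of_approx (m := ⌊k * a / π⌋ + 1) (n := ⌊k * b / π⌋ + 1)
    (u := 1 - Int.fract (k * a / π)) (v := 1 - Int.fract (k * b / π)) hs hs5 (by positivity)
    (by linarith [Int.fract_lt_one (k * a / π)]) (by linarith [Int.fract_lt_one (k * b / π)])
    ?_ ?_ ?_
  · rw [Int.fract]; push_cast; ring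
  · have : k * b / π = k * a / π * ((s - 1) / 2) := by rw [hb]; ring
    rw [← this, Int.fract]; push_cast; ring
  · have h3 := mul_le_mul_of_nonneg_left (add_le_add h1 h2) (by positivity : 0 ≤ 2 * k)
    have h4 := h3.trans hlt.le
    rw [le_div_iff₀ (by positivity)]
    calc _ = a * (2 * k * (π / 2 * (1 - Int.fract (k * a / π))
          + π / 2 * (1 - Int.fract (k * b / π)))) := by field_simp
      _ ≤ a * |α| := by gcongr
      _ = _ := mul_comm _ _

theorem nonempty_gapSetMinus {a b α : ℝ} (ha : 0 < a) (hb : 0 < b) (hab : b < a)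
    (hα : 2 * (π / a) * Real.cot (π / a * b / 2) < |α|) : (gapSetMinus a b α).Nonempty := by
  have hpi := Real.pi_pos
  have hK : 0 < π / a := by positivity
  have hKb : π / a * b < π := by
    rw [div_mul_eq_mul_div, div_lt_iff₀ ha]; gcongr
  have hKa : π / a * a / 2 = π / 2 := by field_simp
  have hcont : ContinuousAt (fun k : ℝ => 2 * k * (cos (k * a / 2) / sin (k * a / 2)
      + cos (k * b / 2) / sin (k * b / 2))) (π / a) := by
    have hs1 : sin (π / a * a / 2) ≠ 0 := by rw [hKa]; simp
    have hs2 : sin (π / a * b / 2) ≠ 0 :=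
      (sin_pos_of_pos_of_lt_pi (by positivity) (by linarith)).ne'
    fun_prop (disch := assumption)
  have hev := hcont.eventually_lt (continuousAt_const (y := |α|)) (by
    rw [hKa, cos_pi_div_two, zero_div, zero_add, ← Real.cot_eq_cos_div_sin]
    exact hα)
  obtain ⟨k, ⟨hk, hkK⟩, hk0⟩ := ((hev.filter_mono nhdsWithin_le_nhds).and
    (self_mem_nhdsWithin : Set.Iio (π / a) ∈ nhdsWithin (π / a) (Set.Iio (π / a)))
    |>.and (mem_nhdsWithin_of_mem_nhds (Ioi_mem_nhds hK))).exists
  have hk0 : 0 < k := hk0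
  have hkK : k < π / a := hkK
  have ha1 : k * a / π < 1 := by
    rw [div_lt_one hpi]; exact (lt_div_iff₀ ha).1 hkK
  have hb1 : k * b / π < 1 := lt_trans (by gcongr) ha1
  have hne : ∀ x : ℝ, 0 < x → x < 1 → ∀ n : ℤ, x ≠ n := by
    rintro x h0 h1 n rfl
    have h0' : 0 < n := by exact_mod_cast h0
    have h1' : n < 1 := by exact_mod_cast h1
    omega
  have ha0 : 0 < k * a / π := by positivity
  have hb0 : 0 < k * b / π := by positivity
  refine ⟨k, hk0, hne _ ha0 ha1, hne _ hb0 hb1, ?_⟩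
  rw [Int.floor_eq_zero_iff.2 ⟨ha0.le, ha1⟩, Int.floor_eq_zero_iff.2 ⟨hb0.le, hb1⟩]
  simpa [Real.cot_eq_cos_div_sin] using hk

/-- For the golden-mean rectangular lattice (`a/b = (1+√5)/2`) with
`−π²/(√5 a) < α < −(2π/a)·tan((3−√5)π/4)`, there is a nonzero and finite number of
gaps in the positive spectrum: the gap set is nonempty and has finitely many
connected components. -/
theorem golden_mean_lattice_bethe_sommerfeld
    (a b α : ℝ) (ha : 0 < a) (hb : 0 < b) (hab : a / b = (1 + Real.sqrt 5) / 2)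
    (h₁ : -(π ^ 2 / (Real.sqrt 5 * a)) < α)
    (h₂ : α < -(2 * π / a * Real.tan ((3 - Real.sqrt 5) * π / 4))) :
    (gapSetMinus a b α).Nonempty ∧ (gapComponents (gapSetMinus a b α)).Finite := by
  have hpi := Real.pi_pos
  have hs : 0 ≤ √5 := Real.sqrt_nonneg 5
  have hs5 : √5 ^ 2 = 5 := Real.sq_sqrt (by norm_num)
  have hs2 : 2 < √5 := by nlinarith
  have hs3 : √5 < 3 := by nlinarith
  have hb' : b = a * ((√5 - 1) / 2) := by
    rw [div_eq_iff hb.ne'] at hab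
    rw [hab]
    linear_combination (-(b / 4)) * hs5
  have hba : b < a := by rw [hb']; nlinarith
  have htan : 0 < Real.tan ((3 - √5) * π / 4) :=
    Real.tan_pos_of_pos_of_lt_pi_div_two
      (by apply div_pos (mul_pos _ hpi) <;> linarith) (by nlinarith)
  have hα0 : α < 0 := h₂.trans (neg_neg_of_pos (by positivity))
  have hα : |α| = -α := abs_of_neg hα0
  constructor
  · apply nonempty_gapSetMinus ha hb hba
    have harg : π / a * b / 2 = π / 2 - (3 - √5) * π / 4 := by
      rw [hb']; field_simp; ring
    rw [harg, ← Real.tan_inv_eq_cot, Real.tan_pi_div_two_sub, inv_inv, hα]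
    have : 2 * (π / a) = 2 * π / a := by ring
    rw [this]
    linarith
  · have hc : √5 * (|α| * a / π ^ 2) < 1 := by
      have h : |α| < π ^ 2 / (√5 * a) := by rw [hα]; linarith
      rw [lt_div_iff₀ (by positivity)] at h
      rw [← mul_div_assoc, div_lt_one (by positivity)]
      linarith
    set M := 2 * (|α| * a / π ^ 2) ^ 2 / (1 - √5 * (|α| * a / π ^ 2))
    refine finite_gapComponents_of_subset_iUnion
      ((Set.finite_Icc 0 ⌊M + 1⌋).prod (Set.finite_Icc 0 ⌊M + 1⌋))
      (isPreconnected_gapCell ha hb α) (fun _ _ h => h.1) fun k hk => ?_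
    have hM := sq_le_of_mem_gapSetMinus ha hs hs5 hb' hc hk
    have hk0 : 0 < k := hk.1
    have hxM : k * a / π ≤ M + 1 := by nlinarith [sq_nonneg (k * a / π - 1)]
    have hyM : k * b / π ≤ M + 1 := le_trans (by gcongr) hxM
    exact ⟨(⌊k * a / π⌋, ⌊k * b / π⌋),
      ⟨⟨Int.floor_nonneg.2 (by positivity), Int.floor_le_floor hxM⟩,
        ⟨Int.floor_nonneg.2 (by positivity), Int.floor_le_floor hyM⟩⟩, hk, rfl, rfl⟩
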